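/- arXiv:2503.02818 — 7 statements merged into one kernel-verified Lean document; each statement's English description precedes it below -/
import Mathlib

section
/- The Burnside kernel is reversible with respect to π: for all x, y ∈ X, π(x)·P(x,y) = π(y)·P(y,x), where π(x) = 1/(Z·|O_x|). -/
open MulAction

/-- `|X^g|`: the number of points of `X` fixed by `g`. -/
def fixedCard (G X : Type*) [Group G] [Fintype X] [DecidableEq X] [MulAction G X] (g : G) : ℕ :=
  (Finset.univ.filter (fun x : X => g • x = x)).card

/-- The Burnside kernel `P(x,y) = (1/|G_x|) · Σ_{g ∈ G_x ∩ G_y} 1/|X^g|`. -/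
noncomputable def burnsideP (G : Type*) {X : Type*} [Group G] [Fintype G] [Fintype X]
    [DecidableEq X] [MulAction G X] (x y : X) : ℝ :=
  (1 / (Nat.card (stabilizer G x) : ℝ)) *
    ∑ g ∈ Finset.univ.filter (fun g : G => g • x = x ∧ g • y = y),
      1 / (fixedCard G X g : ℝ)

/-- `π(x) = 1/(Z · |O_x|)`, where `Z` is the number of orbits of `G` on `X`. -/
noncomputable def burnsidePi (G : Type*) {X : Type*} [Group G] [MulAction G X] (x : X) : ℝ :=
  1 / ((Nat.card (orbitRel.Quotient G X) : ℝ) * (Nat.card (orbit G x) : ℝ))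

theorem card_orbit_mul_card_stabilizer_cast (G : Type*) {X : Type*} [Group G] [MulAction G X]
    (x : X) :
    (Nat.card (orbit G x) : ℝ) * (Nat.card (stabilizer G x) : ℝ) = (Nat.card G : ℝ) := by
  rw [← Nat.cast_mul, ← Nat.card_prod,
    Nat.card_congr (orbitProdStabilizerEquivGroup G x)]

/-- The symmetric form of `π(x)·P(x,y)`. -/
theorem burnsidePi_mul_burnsideP {G X : Type*} [Group G] [Fintype G] [Fintype X]
    [DecidableEq X] [MulAction G X] (x y : X) :
    burnsidePi G x * burnsideP G x y =
      1 / ((Nat.card (orbitRel.Quotient G X) : ℝ) * (Nat.card G : ℝ)) *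
        ∑ g ∈ Finset.univ.filter (fun g : G => g • x = x ∧ g • y = y),
          1 / (fixedCard G X g : ℝ) := by
  rw [burnsidePi, burnsideP, ← mul_assoc, one_div_mul_one_div, mul_assoc,
    card_orbit_mul_card_stabilizer_cast]

/-- The Burnside kernel is reversible with respect to `π(x) = 1/(Z·|O_x|)`:
for all `x, y ∈ X`, `π(x)·P(x,y) = π(y)·P(y,x)`. -/
theorem burnside_reversible {G X : Type*} [Group G] [Fintype G] [Fintype X] [Nonempty X]
    [DecidableEq X] [MulAction G X] (x y : X) :
    burnsidePi G x * burnsideP G x y = burnsidePi G y * burnsideP G y x := by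
  rw [burnsidePi_mul_burnsideP, burnsidePi_mul_burnsideP]
  simp only [and_comm]
end

section
/- The lumped Burnside kernel is well defined: for all x, u, y ∈ X, if u lies in the orbit O_x of x, then Σ_{z ∈ O_y} P(x,z) = Σ_{z ∈ O_y} P(u,z). Consequently P̄(O_x, O_y) := Σ_{z ∈ O_y} P(x,z) does not depend on the choice of representative x of the orbit O_x. -/
open MulAction

theorem fixedCard_conj {G X : Type*} [Group G] [Fintype X] [DecidableEq X] [MulAction G X]
    (h g : G) : fixedCard G X (h * g * h⁻¹) = fixedCard G X g := by
  unfold fixedCard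
  refine (Finset.card_equiv (MulAction.toPerm h) fun x => ?_).symm
  simp [mul_smul]

theorem burnsideP_smul_smul {G X : Type*} [Group G] [Fintype G] [Fintype X] [DecidableEq X]
    [MulAction G X] (h : G) (x z : X) : burnsideP G (h • x) (h • z) = burnsideP G x z := by
  unfold burnsideP
  congr 1
  · rw [Nat.card_congr (stabilizerEquivStabilizer (g := h) (a := x) rfl).toEquiv]
  · refine (Finset.sum_equiv (MulAut.conj h).toEquiv (fun g => ?_) fun g _ => ?_).symm
    · simp [mul_smul]
    · simp [fixedCard_conj]

/-- The lumped Burnside kernel is well defined: if `u` lies in the orbit of `x`, then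
`Σ_{z ∈ O_y} P(x,z) = Σ_{z ∈ O_y} P(u,z)`; hence `P̄(O_x, O_y) := Σ_{z ∈ O_y} P(x,z)`
does not depend on the choice of representative of the orbit `O_x`. -/
theorem lumped_well_defined {G X : Type*} [Group G] [Fintype G] [Fintype X] [Nonempty X]
    [DecidableEq X] [MulAction G X] (x u y : X) (hu : u ∈ orbit G x) :
    ∑ z : X, (orbit G y).indicator (burnsideP G x) z
      = ∑ z : X, (orbit G y).indicator (burnsideP G u) z := by
  obtain ⟨h, rfl⟩ := hu
  refine Fintype.sum_equiv (MulAction.toPerm h) _ _ fun z => ?_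
  classical
  simp only [Set.indicator_apply, MulAction.toPerm_apply, burnsideP_smul_smul,
    ← orbit_eq_iff, orbit_smul]
end

section
/- The lumped Burnside kernel is symmetric: for all x, y ∈ X, Σ_{z ∈ O_y} P(x,z) = Σ_{z ∈ O_x} P(y,z); that is, P̄(O_x, O_y) = P̄(O_y, O_x). Hence the uniform distribution on the set of orbits X/G is a stationary distribution of P̄. -/
open MulAction

/-- The lumped Burnside kernel on orbits: `P̄(O, O') = Σ_{z ∈ O'} P(x, z)` where `x` is a
representative of the orbit `O`. -/
noncomputable def lumpedP (G : Type*) {X : Type*} [Group G] [Fintype G] [Fintype X]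
    [DecidableEq X] [MulAction G X] (o o' : orbitRel.Quotient G X) : ℝ :=
  ∑ z : X, (orbit G (Quotient.out o')).indicator (burnsideP G (Quotient.out o)) z

theorem card_filter_smul_eq {G X : Type*} [Group G] [Fintype G] [DecidableEq X] [MulAction G X]
    (y z : X) [Decidable (z ∈ orbit G y)] :
    (Finset.univ.filter (fun h : G => h • y = z)).card =
      if z ∈ orbit G y then Nat.card (stabilizer G y) else 0 := by
  split_ifs with hz
  · obtain ⟨k, rfl⟩ := hz
    rw [← Fintype.card_subtype, ← Nat.card_eq_fintype_card]
    refine Nat.card_congr ((Equiv.mulLeft k⁻¹).subtypeEquiv fun h => ?_)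
    simp [mem_stabilizer_iff, mul_smul, inv_smul_eq_iff]
  · rw [Finset.card_eq_zero, Finset.filter_eq_empty_iff]
    exact fun h _ hh => hz ⟨h, hh⟩

/-- The symmetric, diagonally invariant part `Σ_{g ∈ G_x ∩ G_y} 1/|X^g|` of the Burnside kernel. -/
noncomputable def burnsideWeight (G : Type*) {X : Type*} [Group G] [Fintype G] [Fintype X]
    [DecidableEq X] [MulAction G X] (x y : X) : ℝ :=
  ∑ g : G, if g • x = x ∧ g • y = y then 1 / (fixedCard G X g : ℝ) else 0

section BurnsideKernel

variable {G X : Type*} [Group G] [Fintype G] [Fintype X] [DecidableEq X] [MulAction G X]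

theorem burnsideP_eq (x y : X) :
    burnsideP G x y = (1 / (Nat.card (stabilizer G x) : ℝ)) * burnsideWeight G x y := by
  rw [burnsideP, burnsideWeight, Finset.sum_filter]

theorem burnsideWeight_comm (x y : X) : burnsideWeight G x y = burnsideWeight G y x := by
  simp only [burnsideWeight, and_comm]

theorem burnsideWeight_smul_smul (h : G) (x y : X) :
    burnsideWeight G (h • x) (h • y) = burnsideWeight G x y := by
  unfold burnsideWeight
  rw [← (MulAut.conj h).toEquiv.sum_comp]
  simp [MulAut.conj_apply, fixedCard_conj, mul_smul]

/-- Averaging over the group counts every point of the orbit `|G_y|` times. -/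
theorem sum_smul_eq_card_stabilizer_mul (f : X → ℝ) (y : X) :
    ∑ h : G, f (h • y) =
      (Nat.card (stabilizer G y) : ℝ) * ∑ z : X, (orbit G y).indicator f z := by
  classical
  rw [← Finset.sum_fiberwise Finset.univ (fun h : G => h • y), Finset.mul_sum]
  refine Finset.sum_congr rfl fun z _ => ?_
  rw [Finset.sum_congr rfl (g := fun _ => f z) (by simp +contextual), Finset.sum_const,
    card_filter_smul_eq, Set.indicator_apply]
  split_ifs <;> simp

theorem sum_indicator_orbit_burnsideP (x y : X) :
    ∑ z : X, (orbit G y).indicator (burnsideP G x) z =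
      (1 / (Nat.card (stabilizer G x) : ℝ)) * (1 / (Nat.card (stabilizer G y) : ℝ)) *
        ∑ h : G, burnsideWeight G x (h • y) := by
  have hy : (Nat.card (stabilizer G y) : ℝ) ≠ 0 := Nat.cast_ne_zero.mpr Nat.card_pos.ne'
  have key := sum_smul_eq_card_stabilizer_mul (G := G) (burnsideP G x) y
  simp only [burnsideP_eq x, ← Finset.mul_sum] at key
  rw [mul_right_comm, key]
  field_simp

theorem sum_indicator_orbit_burnsideP_comm (x y : X) :
    ∑ z : X, (orbit G y).indicator (burnsideP G x) z =
      ∑ z : X, (orbit G x).indicator (burnsideP G y) z := by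
  rw [sum_indicator_orbit_burnsideP, sum_indicator_orbit_burnsideP,
    mul_comm (1 / (Nat.card (stabilizer G x) : ℝ)), ← Equiv.sum_comp (Equiv.inv G)]
  congr 1
  refine Finset.sum_congr rfl fun h _ => ?_
  rw [← burnsideWeight_smul_smul h, Equiv.inv_apply, smul_inv_smul, burnsideWeight_comm]

theorem sum_burnsideP (x : X) : ∑ y : X, burnsideP G x y = 1 := by
  have hx : (Nat.card (stabilizer G x) : ℝ) ≠ 0 := Nat.cast_ne_zero.mpr Nat.card_pos.ne'
  have fixed (g : G) : (∑ y : X, if g • x = x ∧ g • y = y then 1 / (fixedCard G X g : ℝ) else 0) =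
      if g • x = x then 1 else 0 := by
    split_ifs with hg
    · have : (fixedCard G X g : ℝ) ≠ 0 := by
        refine Nat.cast_ne_zero.mpr (Finset.card_pos.mpr ⟨x, ?_⟩).ne'
        simpa using hg
      simp only [hg, true_and, ← Finset.sum_filter, Finset.sum_const, nsmul_eq_mul]
      exact mul_one_div_cancel this
    · simp [hg]
  simp only [burnsideP_eq, ← Finset.mul_sum, burnsideWeight]
  rw [Finset.sum_comm]
  simp only [fixed, Finset.sum_boole]
  classical
  rw [card_filter_smul_eq, if_pos (mem_orbit_self x), one_div_mul_cancel hx]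

theorem sum_lumpedP [Fintype (orbitRel.Quotient G X)] (o : orbitRel.Quotient G X) :
    ∑ o' : orbitRel.Quotient G X, lumpedP G o o' = 1 := by
  classical
  unfold lumpedP
  rw [Finset.sum_comm, ← sum_burnsideP (G := G) (Quotient.out o)]
  refine Finset.sum_congr rfl fun z _ => ?_
  have mem (o' : orbitRel.Quotient G X) :
      z ∈ orbit G (Quotient.out o') ↔ (Quotient.mk (orbitRel G X) z) = o' := by
    rw [← orbitRel_apply, ← Quotient.eq (r := orbitRel G X), Quotient.out_eq]
  simp [Set.indicator_apply, mem]

end BurnsideKernel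

/-- The lumped Burnside kernel is symmetric: `Σ_{z ∈ O_y} P(x,z) = Σ_{z ∈ O_x} P(y,z)`,
i.e. `P̄(O_x, O_y) = P̄(O_y, O_x)`. Hence the uniform distribution on the set of orbits
`X/G` is a stationary distribution of `P̄`. -/
theorem lumped_symmetric {G X : Type*} [Group G] [Fintype G] [Fintype X] [Nonempty X]
    [DecidableEq X] [MulAction G X] [Fintype (orbitRel.Quotient G X)] :
    (∀ x y : X,
      ∑ z : X, (orbit G y).indicator (burnsideP G x) z
        = ∑ z : X, (orbit G x).indicator (burnsideP G y) z) ∧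
    (∀ o : orbitRel.Quotient G X,
      ∑ o' : orbitRel.Quotient G X,
          (1 / (Nat.card (orbitRel.Quotient G X) : ℝ)) * lumpedP G o' o
        = 1 / (Nat.card (orbitRel.Quotient G X) : ℝ)) := by
  refine ⟨sum_indicator_orbit_burnsideP_comm, fun o => ?_⟩
  have symm (o' : orbitRel.Quotient G X) : lumpedP G o' o = lumpedP G o o' :=
    sum_indicator_orbit_burnsideP_comm _ _
  rw [← Finset.mul_sum, Finset.sum_congr rfl fun o' _ => symm o', sum_lumpedP, mul_one]
end

section
/- The map f is constant on (S_λ, S_μ) double cosets and induces a bijection between the set of double cosets S_λ\S_n/S_μ and the set T_{λ,μ} of I × J contingency tables with row sums λ and column sums μ. Explicitly: f(σ) = f(τ) if and only if S_λ σ S_μ = S_λ τ S_μ, and the image of f is exactly T_{λ,μ}. -/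
/-- The sum of the block sizes before index `i`. -/
def blockOffset {I : ℕ} (lam : Fin I → ℕ) (i : Fin I) : ℕ :=
  ∑ i' ∈ Finset.univ.filter (fun i' : Fin I => i' < i), lam i'

/-- The `i`-th consecutive block `L_i` of `{1,…,n}` (realized as `Fin n`) for the
composition `lam`. -/
def blockF (n : ℕ) {I : ℕ} (lam : Fin I → ℕ) (i : Fin I) : Finset (Fin n) :=
  Finset.univ.filter (fun x : Fin n =>
    blockOffset lam i ≤ (x : ℕ) ∧ (x : ℕ) < blockOffset lam i + lam i)

/-- The Young (parabolic) subgroup `S_λ = {σ : σ(L_i) = L_i for all i}`. -/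
def young (n : ℕ) {I : ℕ} (lam : Fin I → ℕ) : Set (Equiv.Perm (Fin n)) :=
  {σ | ∀ i : Fin I, (blockF n lam i).image ⇑σ = blockF n lam i}

/-- The contingency table `f(σ)_{i,j} = |L_i ∩ σ(M_j)|`. -/
def tab (n : ℕ) {I J : ℕ} (lam : Fin I → ℕ) (mu : Fin J → ℕ) (σ : Equiv.Perm (Fin n)) :
    Fin I → Fin J → ℕ :=
  fun i j => (blockF n lam i ∩ (blockF n mu j).image ⇑σ).card

open Finset in
/-- Two maps with equinumerous fibers differ by an equivalence of their domains. -/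
theorem exists_equiv_of_card_fiber_eq {α β γ : Type*} [Fintype α] [Fintype β] [DecidableEq γ]
    (f : α → γ) (g : β → γ) (h : ∀ c, #{x | f x = c} = #{y | g y = c}) :
    ∃ e : α ≃ β, ∀ x, g (e x) = f x := by
  have E (c : γ) : {x // f x = c} ≃ {y // g y = c} :=
    Fintype.equivOfCardEq (by simpa only [Fintype.card_subtype] using h c)
  exact ⟨Equiv.ofFiberEquiv E, Equiv.ofFiberEquiv_map E⟩

theorem blockOffset_eq_sum_castLE {I : ℕ} (lam : Fin I → ℕ) (i : Fin I) :
    blockOffset lam i = ∑ k : Fin i, lam (Fin.castLE i.2.le k) := by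
  unfold blockOffset
  symm
  refine Finset.sum_bij (fun k _ => Fin.castLE i.2.le k) ?_ ?_ ?_ ?_
  · intro k _
    exact Finset.mem_filter.2 ⟨Finset.mem_univ _, k.2⟩
  · intro k _ l _ hkl
    simpa using hkl
  · intro k hk
    exact ⟨⟨k, (Finset.mem_filter.1 hk).2⟩, Finset.mem_univ _, rfl⟩
  · simp

open Finset in
/-- The blocks of a composition are the fibers of a labelling, with the prescribed sizes. -/
theorem exists_block_label {n I : ℕ} (lam : Fin I → ℕ) (hsum : ∑ i, lam i = n) :
    ∃ a : Fin n → Fin I, (∀ i x, x ∈ blockF n lam i ↔ a x = i) ∧ ∀ i, #{x | a x = i} = lam i := by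
  subst hsum
  have hmem (i : Fin I) (x : Fin (∑ i, lam i)) : x ∈ blockF _ lam i ↔ (finSigmaFinEquiv.symm x).1 = i := by
    obtain ⟨⟨j, k⟩, rfl⟩ := finSigmaFinEquiv.surjective x
    have hmono {p q : Fin I} (hpq : p < q) : blockOffset lam p + lam p ≤ blockOffset lam q := by
      unfold blockOffset
      rw [add_comm, ← Finset.sum_insert (by simp)]
      refine Finset.sum_le_sum_of_subset fun r hr => ?_
      simp only [mem_insert, mem_filter, mem_univ, true_and] at hr ⊢
      rcases hr with rfl | hr
      · exact hpq
      · exact hr.trans hpq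
    simp only [blockF, mem_filter, mem_univ, true_and, Equiv.symm_apply_apply,
      finSigmaFinEquiv_apply, ← blockOffset_eq_sum_castLE]
    have hk := k.2
    constructor
    · intro h
      rcases lt_trichotomy j i with hji | hji | hji
      · have := hmono hji
        omega
      · exact hji
      · have := hmono hji
        omega
    · rintro rfl
      omega
  refine ⟨fun x => (finSigmaFinEquiv.symm x).1, hmem, fun i => ?_⟩
  rw [← Fintype.card_subtype, Fintype.card_congr
    ((finSigmaFinEquiv.symm.subtypeEquiv fun _ => Iff.rfl).trans (Equiv.sigmaSubtype i))]
  simp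

theorem mem_young_iff_of_label {n I : ℕ} {lam : Fin I → ℕ} {a : Fin n → Fin I}
    (ha : ∀ i x, x ∈ blockF n lam i ↔ a x = i) (σ : Equiv.Perm (Fin n)) :
    σ ∈ young n lam ↔ ∀ x, a (σ x) = a x := by
  constructor
  · intro h x
    rw [← ha, ← h (a x)]
    exact Finset.mem_image_of_mem _ ((ha _ _).2 rfl)
  · intro h i
    refine Finset.eq_of_subset_of_card_le (fun y hy => ?_)
      (Finset.card_image_of_injective _ σ.injective).ge
    obtain ⟨x, hx, rfl⟩ := Finset.mem_image.1 hy
    rw [ha] at hx ⊢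
    rw [h, hx]

open Finset in
theorem tab_eq_card_of_label {n I J : ℕ} {lam : Fin I → ℕ} {mu : Fin J → ℕ}
    {a : Fin n → Fin I} {b : Fin n → Fin J} (ha : ∀ i x, x ∈ blockF n lam i ↔ a x = i)
    (hb : ∀ j x, x ∈ blockF n mu j ↔ b x = j) (σ : Equiv.Perm (Fin n)) (i : Fin I) (j : Fin J) :
    tab n lam mu σ i j = #{x | (a (σ x), b x) = (i, j)} := by
  refine (congrArg card ?_).trans (card_image_of_injective _ σ.injective)
  ext y
  simp only [mem_inter, mem_image, ha, hb, mem_filter, mem_univ, true_and, Prod.mk.injEq]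
  constructor
  · rintro ⟨hy, x, hx, rfl⟩
    exact ⟨x, ⟨hy, hx⟩, rfl⟩
  · rintro ⟨x, ⟨hy, hx⟩, rfl⟩
    exact ⟨hy, x, hx, rfl⟩

/-- The subgroup of permutations preserving a labelling of the points. -/
def labelStabilizer {α ι : Type*} (a : α → ι) : Subgroup (Equiv.Perm α) where
  carrier := {σ | ∀ x, a (σ x) = a x}
  one_mem' _ := rfl
  mul_mem' {σ τ} hσ hτ x := (hσ (τ x)).trans (hτ x)
  inv_mem' {σ} hσ x := by simpa using (hσ (σ⁻¹ x)).symm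

theorem coe_labelStabilizer_eq_young {n I : ℕ} {lam : Fin I → ℕ} {a : Fin n → Fin I}
    (ha : ∀ i x, x ∈ blockF n lam i ↔ a x = i) :
    (labelStabilizer a : Set (Equiv.Perm (Fin n))) = young n lam :=
  Set.ext fun σ => (mem_young_iff_of_label ha σ).symm

open Finset in
/-- Permutations have the same joint label counts iff they lie in the same double coset. -/
theorem card_label_eq_iff_mem_doubleCoset {α ι κ : Type*} [Fintype α] [DecidableEq ι]
    [DecidableEq κ] (a : α → ι) (b : α → κ) (σ τ : Equiv.Perm α) :
    (∀ c, #{x | (a (σ x), b x) = c} = #{x | (a (τ x), b x) = c}) ↔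
      σ ∈ DoubleCoset.doubleCoset τ (labelStabilizer a) (labelStabilizer b) := by
  rw [DoubleCoset.mem_doubleCoset]
  constructor
  · intro h
    obtain ⟨e, he⟩ := exists_equiv_of_card_fiber_eq _ _ h
    simp only [Prod.mk.injEq] at he
    refine ⟨σ * e⁻¹ * τ⁻¹, fun x => ?_, e, fun x => (he x).2, by group⟩
    simpa using (he (e⁻¹ (τ⁻¹ x))).1.symm
  · rintro ⟨h, hh, k, hk, rfl⟩ c
    refine card_equiv k fun x => ?_
    have hx : a ((h * τ * k) x) = a (τ (k x)) := hh (τ (k x))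
    have hkx : b (k x) = b x := hk x
    simp only [mem_filter_univ, hx, hkx]

open Finset in
/-- Every table whose margins are the fiber sizes is the table of joint label counts of some
permutation. -/
theorem exists_perm_card_label_eq {α ι κ : Type*} [Fintype α] [Fintype ι] [Fintype κ]
    [DecidableEq ι] [DecidableEq κ] (a : α → ι) (b : α → κ) (T : ι → κ → ℕ)
    (hrow : ∀ i, ∑ j, T i j = #{x | a x = i}) (hcol : ∀ j, ∑ i, T i j = #{x | b x = j}) :
    ∃ σ : Equiv.Perm α, ∀ i j, #{x | (a (σ x), b x) = (i, j)} = T i j := by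
  let β := Σ p : ι × κ, Fin (T p.1 p.2)
  have hcard (P : ι × κ → Prop) [DecidablePred P] :
      #{y : β | P y.1} = ∑ p with P p, T p.1 p.2 := by
    have : ({y : β | P y.1} : Finset β) = ({p | P p} : Finset (ι × κ)).sigma fun _ => univ := by
      ext y; rw [mem_sigma]; simp
    rw [this, card_sigma]
    simp
  obtain ⟨e, he⟩ := exists_equiv_of_card_fiber_eq (fun y : β => y.1.1) a fun i => by
    rw [hcard (fun p => p.1 = i), ← hrow, sum_filter, Fintype.sum_prod_type]
    simp
  obtain ⟨d, hd⟩ := exists_equiv_of_card_fiber_eq (fun y : β => y.1.2) b fun j => by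
    rw [hcard (fun p => p.2 = j), ← hcol, sum_filter, Fintype.sum_prod_type]
    simp
  refine ⟨d.symm.trans e, fun i j => ?_⟩
  rw [← card_equiv (s := {y : β | y.1 = (i, j)}) d fun y => ?_, hcard (fun p => p = (i, j))]
  · simp [filter_eq']
  · simp [he, hd, Prod.ext_iff]

/-- The map `f` is constant on `(S_λ, S_μ)` double cosets — `f(σ) = f(τ)` iff
`S_λ σ S_μ = S_λ τ S_μ` — and its image is exactly the set `T_{λ,μ}` of contingency
tables with row sums `λ` and column sums `μ`; hence it induces a bijection between
`S_λ\S_n/S_μ` and `T_{λ,μ}`. -/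
theorem tab_double_coset_bijection (n I J : ℕ) (lam : Fin I → ℕ) (mu : Fin J → ℕ)
    (hlam : ∀ i, 0 < lam i) (hmu : ∀ j, 0 < mu j)
    (hlamsum : ∑ i, lam i = n) (hmusum : ∑ j, mu j = n) :
    (∀ σ τ : Equiv.Perm (Fin n),
      tab n lam mu σ = tab n lam mu τ ↔
        {ρ : Equiv.Perm (Fin n) | ∃ h ∈ young n lam, ∃ k ∈ young n mu, ρ = h * σ * k}
          = {ρ : Equiv.Perm (Fin n) | ∃ h ∈ young n lam, ∃ k ∈ young n mu, ρ = h * τ * k}) ∧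
    Set.range (tab n lam mu)
      = {T : Fin I → Fin J → ℕ |
          (∀ i, ∑ j, T i j = lam i) ∧ (∀ j, ∑ i, T i j = mu j)} := by
  obtain ⟨a, ha, hacard⟩ := exists_block_label lam hlamsum
  obtain ⟨b, hb, hbcard⟩ := exists_block_label mu hmusum
  have htab := tab_eq_card_of_label ha hb
  constructor
  · intro σ τ
    have hcoset (ρ : Equiv.Perm (Fin n)) :
        {π : Equiv.Perm (Fin n) | ∃ h ∈ young n lam, ∃ k ∈ young n mu, π = h * ρ * k} =
          DoubleCoset.doubleCoset ρ (labelStabilizer a) (labelStabilizer b) := by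
      ext π
      rw [DoubleCoset.mem_doubleCoset, coe_labelStabilizer_eq_young ha,
        coe_labelStabilizer_eq_young hb]
      rfl
    rw [hcoset, hcoset]
    trans σ ∈ DoubleCoset.doubleCoset τ (labelStabilizer a) (labelStabilizer b)
    · rw [← card_label_eq_iff_mem_doubleCoset]
      simp only [funext_iff, htab, Prod.forall]
    · exact ⟨fun h => DoubleCoset.doubleCoset_eq_of_mem h,
        fun h => h ▸ DoubleCoset.mem_doubleCoset_self _ _ σ⟩
  · ext T
    constructor
    · rintro ⟨σ, rfl⟩
      constructor
      · intro i
        simp only [htab, Prod.mk.injEq]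
        rw [← hacard i, ← Finset.card_equiv (s := {x | a (σ x) = i}) σ (by simp),
          Finset.card_eq_sum_card_fiberwise (f := b) (t := Finset.univ) (by simp)]
        simp [Finset.filter_filter]
      · intro j
        simp only [htab, Prod.mk.injEq]
        rw [← hbcard j, Finset.card_eq_sum_card_fiberwise (f := fun x => a (σ x))
          (t := Finset.univ) (by simp)]
        simp [Finset.filter_filter, and_comm]
    · rintro ⟨hrow, hcol⟩
      obtain ⟨σ, hσ⟩ := exists_perm_card_label_eq a b T (fun i => (hrow i).trans (hacard i).symm)
        fun j => (hcol j).trans (hbcard j).symm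
      exact ⟨σ, by ext i j; rw [htab, hσ]⟩
end

section
/- Fix h ∈ S_λ and k ∈ S_μ and let τ be any permutation in the fixed-point set S_n^{h,k} = {τ ∈ S_n : h⁻¹ τ k = τ}. For l ≥ 1 let X^{(l)} ∈ Z_{≥0}^{I×J} be given by X^{(l)}_{i,j} = the number of l-cycles C of h contained in L_i such that τ⁻¹(C) is an l-cycle of k contained in M_j. Then f(τ) = Σ_{l=1}^n l·X^{(l)}. -/
/-- The cycle of the permutation `h` containing `x`, identified with its support set
(fixed points count as 1-cycles).  Since every cycle has length at most `n`, the orbit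
of `x` under the powers of `h` is `{h^m x : m < n}`. -/
def permOrbit {n : ℕ} (h : Equiv.Perm (Fin n)) (x : Fin n) : Finset (Fin n) :=
  (Finset.range n).image (fun m => (h ^ m) x)

/-- The set of cycles of a permutation, each identified with its support set. -/
def permCycles {n : ℕ} (h : Equiv.Perm (Fin n)) : Finset (Finset (Fin n)) :=
  Finset.univ.image (permOrbit h)

/-- `cycCount h l` is the number of `l`-cycles of `h`; the function `l ↦ cycCount h l`
is the cycle type of `h`. -/
def cycCount {n : ℕ} (h : Equiv.Perm (Fin n)) (l : ℕ) : ℕ :=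
  ((permCycles h).filter (fun C => C.card = l)).card

/-- `X^{(l)}_{i,j}`: the number of `l`-cycles `C` of `h` contained in `L_i` such that
`τ⁻¹(C)` is an `l`-cycle of `k` contained in `M_j`. -/
def Xcount (n : ℕ) {I J : ℕ} (lam : Fin I → ℕ) (mu : Fin J → ℕ)
    (h k τ : Equiv.Perm (Fin n)) (l : ℕ) (i : Fin I) (j : Fin J) : ℕ :=
  ((permCycles h).filter (fun C =>
    C.card = l ∧ C ⊆ blockF n lam i ∧
      C.image ⇑τ⁻¹ ∈ permCycles k ∧ C.image ⇑τ⁻¹ ⊆ blockF n mu j)).card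

theorem mem_permOrbit_iff_sameCycle {n : ℕ} (h : Equiv.Perm (Fin n)) (x y : Fin n) :
    y ∈ permOrbit h x ↔ h.SameCycle x y := by
  simp only [permOrbit, Finset.mem_image, Finset.mem_range]
  constructor
  · rintro ⟨m, -, rfl⟩
    exact ⟨m, by simp⟩
  · intro hxy
    have hcyc : h.IsCycleOn
        ((Finset.univ.filter (h.SameCycle x) : Finset (Fin n)) : Set (Fin n)) := by
      refine ⟨h.bijOn fun z => by simp, fun a ha b hb => ?_⟩
      simp only [Finset.coe_filter, Finset.mem_univ, true_and, Set.mem_ofPred_eq] at ha hb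
      exact ha.symm.trans hb
    obtain ⟨m, hm, hy⟩ := hcyc.exists_pow_eq (a := x) (b := y)
      (by simpa using Equiv.Perm.SameCycle.refl h x) (by simpa using hxy)
    exact ⟨m, hm.trans_le ((Finset.card_le_univ _).trans_eq (Fintype.card_fin n)), hy⟩

theorem permOrbit_eq_of_sameCycle {n : ℕ} {h : Equiv.Perm (Fin n)} {x y : Fin n}
    (hxy : h.SameCycle x y) : permOrbit h x = permOrbit h y := by
  ext z
  rw [mem_permOrbit_iff_sameCycle, mem_permOrbit_iff_sameCycle]
  exact ⟨hxy.symm.trans, hxy.trans⟩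

theorem pairwiseDisjoint_permCycles {n : ℕ} (h : Equiv.Perm (Fin n)) :
    (permCycles h : Set (Finset (Fin n))).PairwiseDisjoint id := by
  intro C hC D hD hCD
  simp only [permCycles, Finset.coe_image, Finset.coe_univ, Set.image_univ, Set.mem_range] at hC hD
  obtain ⟨x, rfl⟩ := hC
  obtain ⟨y, rfl⟩ := hD
  refine Finset.disjoint_left.2 fun z hx hy => hCD ?_
  simp only [id, mem_permOrbit_iff_sameCycle] at hx hy
  exact permOrbit_eq_of_sameCycle (hx.trans hy.symm)

/-- Conjugation carries cycles to cycles. -/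
theorem image_permOrbit_of_semiconj {n : ℕ} {h k σ : Equiv.Perm (Fin n)}
    (hσ : σ * h = k * σ) (x : Fin n) :
    (permOrbit h x).image σ = permOrbit k (σ x) := by
  have hpow (m : ℕ) : σ * h ^ m = k ^ m * σ := (SemiconjBy.pow_right (a := σ) hσ m)
  simp only [permOrbit, Finset.image_image]
  refine Finset.image_congr fun m _ => ?_
  simpa using congrArg (fun p : Equiv.Perm (Fin n) => p x) (hpow m)

theorem permOrbit_subset_of_image_eq {n : ℕ} {h : Equiv.Perm (Fin n)} {s : Finset (Fin n)}
    (hs : s.image h = s) {x : Fin n} (hx : x ∈ s) : permOrbit h x ⊆ s := by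
  have hmem (m : ℕ) : (h ^ m) x ∈ s := by
    induction m with
    | zero => simpa using hx
    | succ m ih =>
      rw [pow_succ', Equiv.Perm.mul_apply, ← hs]
      exact Finset.mem_image_of_mem _ ih
  intro y hy
  obtain ⟨m, -, rfl⟩ := Finset.mem_image.1 hy
  exact hmem m

/-- Fix `h ∈ S_λ` and `k ∈ S_μ` and let `τ` be any permutation in the fixed-point set
`S_n^{h,k} = {τ : h⁻¹ τ k = τ}`.  Then `f(τ) = Σ_{l=1}^n l·X^{(l)}`. -/
theorem tab_eq_sum_cycle_tables (n I J : ℕ) (lam : Fin I → ℕ) (mu : Fin J → ℕ)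
    (hlam : ∀ i, 0 < lam i) (hmu : ∀ j, 0 < mu j)
    (hlamsum : ∑ i, lam i = n) (hmusum : ∑ j, mu j = n)
    (h k τ : Equiv.Perm (Fin n))
    (hh : h ∈ young n lam) (hk : k ∈ young n mu)
    (hτ : h⁻¹ * τ * k = τ) (i : Fin I) (j : Fin J) :
    tab n lam mu τ i j = ∑ l ∈ Finset.Icc 1 n, l * Xcount n lam mu h k τ l i j := by
  have hconj : τ⁻¹ * h = k * τ⁻¹ := by
    have h1 : τ * k = h * τ := by
      rw [mul_assoc, inv_mul_eq_iff_eq_mul] at hτ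
      exact hτ
    rw [inv_mul_eq_iff_eq_mul, ← mul_assoc, h1, mul_inv_cancel_right]
  set T := (permCycles h).filter (fun C => C ⊆ blockF n lam i ∧
    C.image ⇑τ⁻¹ ∈ permCycles k ∧ C.image ⇑τ⁻¹ ⊆ blockF n mu j) with hT
  have hunion : blockF n lam i ∩ (blockF n mu j).image ⇑τ = T.biUnion id := by
    ext x
    have hself : x ∈ permOrbit h x :=
      (mem_permOrbit_iff_sameCycle h x x).2 (Equiv.Perm.SameCycle.refl h x)
    simp only [Finset.mem_inter, Finset.mem_biUnion, id, hT, Finset.mem_filter]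
    constructor
    · rintro ⟨hxi, hxj⟩
      obtain ⟨y, hy, rfl⟩ := Finset.mem_image.1 hxj
      refine ⟨permOrbit h (τ y), ⟨Finset.mem_image_of_mem _ (Finset.mem_univ _),
        permOrbit_subset_of_image_eq (hh i) hxi, ?_⟩, hself⟩
      rw [image_permOrbit_of_semiconj hconj, show τ⁻¹ (τ y) = y from τ.symm_apply_apply y]
      exact ⟨Finset.mem_image_of_mem _ (Finset.mem_univ _),
        permOrbit_subset_of_image_eq (hk j) hy⟩
    · rintro ⟨C, ⟨-, hCi, -, hCj⟩, hxC⟩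
      exact ⟨hCi hxC, Finset.mem_image.2
        ⟨τ⁻¹ x, hCj (Finset.mem_image_of_mem _ hxC), τ.apply_symm_apply x⟩⟩
  have hcard : ∀ C ∈ T, C.card ∈ Finset.Icc 1 n := by
    intro C hC
    obtain ⟨x, -, rfl⟩ := Finset.mem_image.1 (Finset.mem_filter.1 hC).1
    rw [Finset.mem_Icc]
    exact ⟨Finset.card_pos.2 ⟨x, (mem_permOrbit_iff_sameCycle h x x).2
      (Equiv.Perm.SameCycle.refl h x)⟩, (Finset.card_le_univ _).trans (by simp)⟩
  have hX (l : ℕ) : Xcount n lam mu h k τ l i j = (T.filter (fun C => C.card = l)).card := by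
    rw [Xcount, hT, Finset.filter_filter]
    congr 1
    exact Finset.filter_congr fun C _ => by tauto
  rw [tab, hunion, Finset.card_biUnion fun C hC D hD hCD =>
    pairwiseDisjoint_permCycles h (Finset.mem_filter.1 hC).1 (Finset.mem_filter.1 hD).1 hCD,
    ← Finset.sum_fiberwise_of_maps_to hcard]
  refine Finset.sum_congr rfl fun l _ => ?_
  rw [hX, Finset.sum_congr rfl (g := fun _ => l) fun C hC => by exact (Finset.mem_filter.1 hC).2,
    Finset.sum_const, smul_eq_mul, mul_comm]
end

section
/- Fix h ∈ S_λ and k ∈ S_μ with S_n^{h,k} = {τ ∈ S_n : h⁻¹ τ k = τ} nonempty, and let τ be uniformly distributed on S_n^{h,k}. For l ≥ 1 let r^{(l)}_i be the number of l-cycles of h_i, c^{(l)}_j the number of l-cycles of k_j, and X^{(l)}_{i,j} the number of l-cycles C of h_i such that τ⁻¹(C) is a cycle of k_j. Then for each l the random table X^{(l)} is distributed according to the Fisher–Yates distribution with row sums r^{(l)} and column sums c^{(l)} (i.e. P(X^{(l)} = x) is proportional to 1/Π_{i,j} x_{i,j}! over tables x with these margins), and the tables (X^{(l)})_{l ≥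 1} are mutually independent. -/
/-- The number of `l`-cycles of a permutation `h` contained in the `i`-th block of the
composition `lam` (for `h ∈ S_λ` this is the number of `l`-cycles of `h_i`). -/
def blockCycCount (n : ℕ) {I : ℕ} (lam : Fin I → ℕ) (h : Equiv.Perm (Fin n))
    (l : ℕ) (i : Fin I) : ℕ :=
  ((permCycles h).filter (fun C => C.card = l ∧ C ⊆ blockF n lam i)).card

/-- The Fisher–Yates distribution on tables with row sums `r` and column sums `c`:
a table `x` with these margins has probability `(Π_i r_i!)(Π_j c_j!)/(N!·Π_{i,j} x_{i,j}!)`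
where `N = Σ_i r_i`, and any other table has probability `0`. -/
def fisherYates {I J : ℕ} (r : Fin I → ℕ) (c : Fin J → ℕ) (x : Fin I → Fin J → ℕ) : ℚ :=
  if (∀ i, ∑ j, x i j = r i) ∧ (∀ j, ∑ i, x i j = c j) then
    (((∏ i, Nat.factorial (r i)) * (∏ j, Nat.factorial (c j)) : ℕ) : ℚ)
      / (((Nat.factorial (∑ i, r i)) * (∏ i, ∏ j, Nat.factorial (x i j)) : ℕ) : ℚ)
  else 0

open Nat in
/-- The number of bijections carrying the colouring `g` back to the colouring `f`. -/
theorem card_equiv_comp_eq {W A Q : Type*} [Finite W] [Finite A] [Fintype Q]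
    (f : W → Q) (g : A → Q)
    [Decidable (∀ q, Nat.card {w // f w = q} = Nat.card {a // g a = q})] :
    Nat.card {e : W ≃ A // g ∘ e = f} =
      if ∀ q, Nat.card {w // f w = q} = Nat.card {a // g a = q}
      then ∏ q, (Nat.card {w // f w = q})! else 0 := by
  classical
  have := Fintype.ofFinite W
  have := Fintype.ofFinite A
  split_ifs with hc
  · let e₀ : W ≃ A := Equiv.ofFiberEquiv (f := f) (g := g) fun q =>
      (Finite.card_eq.1 (hc q)).some
    have he₀ : ∀ w, g (e₀ w) = f w := fun w => Equiv.ofFiberEquiv_map _ w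
    have : Nat.card {e : W ≃ A // g ∘ e = f} = Nat.card {s : Equiv.Perm W // f ∘ s = f} := by
      refine Nat.card_congr (Equiv.subtypeEquiv ((Equiv.refl W).equivCongr e₀.symm) fun e => ?_)
      simp only [funext_iff, Function.comp_apply, Equiv.equivCongr_apply_apply, ← he₀]
      simp 
    rw [this, Nat.card_eq_fintype_card, DomMulAct.stabilizer_card]
    simp [Nat.card_eq_fintype_card]
  · rw [Nat.card_eq_zero]
    refine .inl ⟨fun ⟨e, he⟩ => hc fun q => ?_⟩
    exact Nat.card_congr (e.subtypeEquiv fun w => by simp [← he])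

open Nat in
/-- The number of bijections `e : A ≃ B` with prescribed table of colour pairs `(a c, b (e c))`. -/
theorem card_equiv_table_mul {A B P Q : Type*} [Finite A] [Finite B] [Fintype P] [Fintype Q]
    (a : A → P) (b : B → Q) (X : P → Q → ℕ)
    [Decidable ((∀ p, ∑ q, X p q = Nat.card {c // a c = p}) ∧
      ∀ q, ∑ p, X p q = Nat.card {d // b d = q})] :
    Nat.card {e : A ≃ B // ∀ p q, X p q = Nat.card {c // a c = p ∧ b (e c) = q}} *
        ∏ p, ∏ q, (X p q)! =
      if (∀ p, ∑ q, X p q = Nat.card {c // a c = p}) ∧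
        ∀ q, ∑ p, X p q = Nat.card {d // b d = q}
      then (∏ p, (Nat.card {c // a c = p})!) * ∏ q, (Nat.card {d // b d = q})! else 0 := by
  classical
  have := Fintype.ofFinite A
  have := Fintype.ofFinite B
  let W := Σ t : P × Q, Fin (X t.1 t.2)
  have hW : ∀ p q, Nat.card {w : W // w.1 = (p, q)} = X p q := fun p q => by
    rw [Nat.card_congr (Equiv.sigmaSubtype (p, q)), Nat.card_fin]
  have hP : ∀ p, Nat.card {w : W // w.1.1 = p} = ∑ q, X p q := fun p => by
    let θ : {w : W // w.1.1 = p} ≃ Σ q, Fin (X p q) :=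
      { toFun := fun w => ⟨w.1.1.2, Fin.cast (by rw [w.2]) w.1.2⟩
        invFun := fun v => ⟨⟨(p, v.1), v.2⟩, rfl⟩
        left_inv := by rintro ⟨⟨⟨p, q⟩, i⟩, rfl⟩; rfl
        right_inv := by rintro ⟨q, i⟩; rfl }
    rw [Nat.card_congr θ]
    simp
  have hQ : ∀ q, Nat.card {w : W // w.1.2 = q} = ∑ p, X p q := fun q => by
    let θ : {w : W // w.1.2 = q} ≃ Σ p, Fin (X p q) :=
      { toFun := fun w => ⟨w.1.1.1, Fin.cast (by rw [w.2]) w.1.2⟩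
        invFun := fun v => ⟨⟨(v.1, q), v.2⟩, rfl⟩
        left_inv := by rintro ⟨⟨⟨p, q⟩, i⟩, rfl⟩; rfl
        right_inv := by rintro ⟨q, i⟩; rfl }
    rw [Nat.card_congr θ]
    simp
  let Φ : (Σ e : A ≃ B, {u : W ≃ A // (fun c => (a c, b (e c))) ∘ u = Sigma.fst}) ≃
      {u : W ≃ A // a ∘ u = fun w => w.1.1} × {v : W ≃ B // b ∘ v = fun w => w.1.2} :=
    { toFun := fun t => (⟨t.2.1, funext fun w => congrArg Prod.fst (congrFun t.2.2 w)⟩,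
        ⟨t.2.1.trans t.1, funext fun w => congrArg Prod.snd (congrFun t.2.2 w)⟩)
      invFun := fun t => ⟨t.1.1.symm.trans t.2.1, t.1.1, funext fun w =>
        Prod.ext (congrFun t.1.2 w) (by simpa using congrFun t.2.2 w)⟩
      left_inv := by
        rintro ⟨e, u, hu⟩
        have : u.symm.trans (u.trans e) = e := by ext; simp
        exact Sigma.subtype_ext this rfl
      right_inv := by
        rintro ⟨⟨u, hu⟩, v, hv⟩
        exact Prod.ext rfl (Subtype.ext (by ext; simp)) }
  have key := Nat.card_congr Φ
  rw [Nat.card_sigma, Nat.card_prod, card_equiv_comp_eq, card_equiv_comp_eq] at key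
  simp_rw [card_equiv_comp_eq, Prod.forall, hW, hP, hQ, Fintype.prod_prod_type] at key
  simp only [Prod.mk.injEq] at key
  rw [Finset.sum_ite, Finset.sum_const_zero, add_zero, Finset.sum_const, smul_eq_mul] at key
  rw [Nat.card_eq_fintype_card, Fintype.card_subtype, key]
  by_cases h1 : ∀ p, ∑ q, X p q = Nat.card {c // a c = p}
  · by_cases h2 : ∀ q, ∑ p, X p q = Nat.card {d // b d = q}
    · rw [if_pos h1, if_pos h2, if_pos ⟨h1, h2⟩]
      simp only [h1, h2]
    · rw [if_neg h2, if_neg (mt And.right h2), mul_zero]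
  · rw [if_neg h1, if_neg (mt And.left h1), zero_mul]

theorem Nat.card_eq_sum_card_and {A I : Type*} [Finite A] [Fintype I] (p : A → Prop) (a : A → I) :
    Nat.card {c // p c} = ∑ i, Nat.card {c // p c ∧ a c = i} := by
  rw [← Nat.card_congr (Equiv.sigmaFiberEquiv fun c : {c // p c} => a c), Nat.card_sigma]
  exact Finset.sum_congr rfl fun i _ =>
    Nat.card_congr (Equiv.subtypeSubtypeEquivSubtypeInter p fun c => a c = i)

open Nat in
/-- Among the bijections preserving the levels, those with prescribed tables of colour pairs on
every level have density the product of the Fisher–Yates laws. -/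
theorem card_level_tables_div_card {A B L : Type*} [Finite A] [Finite B] [Fintype L] {I J : ℕ}
    (lA : A → L) (lB : B → L) (a : A → Fin I) (b : B → Fin J)
    (hne : ∃ e : A ≃ B, lB ∘ e = lA) (x : L → Fin I → Fin J → ℕ) :
    (Nat.card {e : A ≃ B // lB ∘ e = lA ∧
        ∀ l i j, Nat.card {c // lA c = l ∧ a c = i ∧ b (e c) = j} = x l i j} : ℚ) /
      Nat.card {e : A ≃ B // lB ∘ e = lA} =
    ∏ l, fisherYates (fun i => Nat.card {c // lA c = l ∧ a c = i})
      (fun j => Nat.card {d // lB d = l ∧ b d = j}) (x l) := by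
  classical
  let X : L × Fin I → L × Fin J → ℕ := fun p q => if p.1 = q.1 then x p.1 p.2 q.2 else 0
  have hset : ∀ e : A ≃ B, (lB ∘ e = lA ∧
      ∀ l i j, Nat.card {c // lA c = l ∧ a c = i ∧ b (e c) = j} = x l i j) ↔
      ∀ p q, X p q = Nat.card {c // (lA c, a c) = p ∧ (lB (e c), b (e c)) = q} := by
    refine fun e => ⟨?_, fun H => ?_⟩
    · rintro ⟨he, H⟩ ⟨l, i⟩ ⟨l', j⟩
      have he' : ∀ c, lB (e c) = lA c := congrFun he
      simp only [X, he', Prod.mk.injEq]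
      split_ifs with hl
      · subst hl
        rw [← H]
        exact Nat.card_congr (Equiv.subtypeEquivRight fun c => by tauto)
      · rw [eq_comm, Nat.card_eq_zero]
        exact .inl ⟨fun c => hl (c.2.1.1.symm.trans c.2.2.1)⟩
    · have he : ∀ c, lB (e c) = lA c := by
        intro c
        by_contra hc
        have h0 := H (lA c, a c) (lB (e c), b (e c))
        simp only [X, if_neg (Ne.symm hc)] at h0
        rw [eq_comm, Nat.card_eq_zero] at h0
        rcases h0 with h0 | h0
        · exact h0.false ⟨c, rfl, rfl⟩
        · exact not_finite_iff_infinite.2 h0 inferInstance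
      refine ⟨funext he, fun l i j => ?_⟩
      have h0 := H (l, i) (l, j)
      simp only [X, if_true] at h0
      rw [h0]
      exact Nat.card_congr (Equiv.subtypeEquivRight fun c => by simp only [he, Prod.mk.injEq]; tauto)
  have key := card_equiv_table_mul (fun c => (lA c, a c)) (fun d => (lB d, b d)) X
  rw [← Nat.card_congr (Equiv.subtypeEquivRight hset)] at key
  have hXprod : ∏ p, ∏ q, (X p q)! = ∏ l, ∏ i, ∏ j, (x l i j)! := by
    simp only [Fintype.prod_prod_type, X, apply_ite Nat.factorial, Nat.factorial_zero]
    refine Finset.prod_congr rfl fun l _ => Finset.prod_congr rfl fun i _ => ?_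
    rw [Finset.prod_comm]
    simp
  have hXrow : ∀ l i, ∑ q, X (l, i) q = ∑ j, x l i j := fun l i => by
    simp only [Fintype.sum_prod_type, X]
    rw [Finset.sum_comm]
    simp
  have hXcol : ∀ l j, ∑ p, X p (l, j) = ∑ i, x l i j := fun l j => by
    simp only [Fintype.sum_prod_type, X]
    rw [Finset.sum_comm]
    simp
  have hden : Nat.card {e : A ≃ B // lB ∘ e = lA} =
      ∏ l, (∑ i, Nat.card {c // lA c = l ∧ a c = i})! := by
    obtain ⟨e, he⟩ := hne
    rw [card_equiv_comp_eq, if_pos]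
    · exact Finset.prod_congr rfl fun l _ => by rw [Nat.card_eq_sum_card_and _ a]
    · exact fun l => Nat.card_congr (e.subtypeEquiv fun c => by simp [← he])
  rw [hXprod] at key
  simp only [Prod.forall, hXrow, hXcol, Fintype.prod_prod_type, Prod.mk.injEq] at key
  rw [hden]
  by_cases hm : ∀ l, (∀ i, ∑ j, x l i j = Nat.card {c // lA c = l ∧ a c = i}) ∧
      ∀ j, ∑ i, x l i j = Nat.card {d // lB d = l ∧ b d = j}
  · rw [if_pos ⟨fun l => (hm l).1, fun l => (hm l).2⟩] at key
    simp only [fisherYates, if_pos (hm _)]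
    rw [Finset.prod_div_distrib, div_eq_div_iff (by positivity) (by positivity)]
    simp only [← Nat.cast_prod, Finset.prod_mul_distrib]
    rw [← key]
    push_cast
    ring
  · rw [if_neg fun h => hm fun l => ⟨h.1 l, h.2 l⟩] at key
    obtain ⟨l, hl⟩ := not_forall.1 hm
    refine Eq.trans ?_ (Finset.prod_eq_zero (Finset.mem_univ l) (if_neg hl)).symm
    have : ∏ l, ∏ i, ∏ j, (x l i j)! ≠ 0 := by positivity
    rw [(_root_.mul_eq_zero.1 key).resolve_right this]
    simp

section Cycles

open Equiv.Perm

variable {n : ℕ} {h k τ : Equiv.Perm (Fin n)} {C : Finset (Fin n)} {x y : Fin n}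

theorem isCycleOn_setOf_sameCycle (h : Equiv.Perm (Fin n)) (x : Fin n) :
    h.IsCycleOn {y | h.SameCycle x y} :=
  ⟨⟨fun z hz => by simpa using hz, h.injective.injOn,
    fun z hz => ⟨h⁻¹ z, by simpa using hz, by simp⟩⟩, fun _ hz _ hw => hz.symm.trans hw⟩

theorem mem_permOrbit : y ∈ permOrbit h x ↔ h.SameCycle x y := by
  classical
  simp only [permOrbit, Finset.mem_image, Finset.mem_range]
  refine ⟨fun ⟨m, _, hm⟩ => ⟨m, by simpa using hm⟩, fun hxy => ?_⟩
  let s : Finset (Fin n) := Finset.univ.filter (h.SameCycle x)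
  have hs : h.IsCycleOn s := by simpa [s] using isCycleOn_setOf_sameCycle h x
  obtain ⟨m, hm, e⟩ := hs.exists_pow_eq (a := x) (b := y)
    (by simp [s, SameCycle.refl]) (by simpa [s] using hxy)
  exact ⟨m, hm.trans_le (by simpa using s.card_le_univ), e⟩

theorem isCycleOn_permOrbit (h : Equiv.Perm (Fin n)) (x : Fin n) :
    h.IsCycleOn (permOrbit h x : Set (Fin n)) := by
  convert isCycleOn_setOf_sameCycle h x
  ext y
  exact mem_permOrbit

theorem self_mem_permOrbit (h : Equiv.Perm (Fin n)) (x : Fin n) : x ∈ permOrbit h x :=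
  mem_permOrbit.2 (SameCycle.refl _ _)

theorem permOrbit_mem_permCycles (h : Equiv.Perm (Fin n)) (x : Fin n) :
    permOrbit h x ∈ permCycles h :=
  Finset.mem_image_of_mem _ (Finset.mem_univ x)

theorem permOrbit_eq_of_mem (hC : C ∈ permCycles h) (hx : x ∈ C) : permOrbit h x = C := by
  obtain ⟨z, -, rfl⟩ := Finset.mem_image.1 hC
  ext w
  rw [mem_permOrbit] at hx
  rw [mem_permOrbit, mem_permOrbit]
  exact ⟨hx.trans, hx.symm.trans⟩

theorem permCycles_nonempty (hC : C ∈ permCycles h) : C.Nonempty := by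
  obtain ⟨z, -, rfl⟩ := Finset.mem_image.1 hC
  exact ⟨z, self_mem_permOrbit h z⟩

theorem card_mem_Icc_of_mem_permCycles (hC : C ∈ permCycles h) : C.card ∈ Finset.Icc 1 n :=
  Finset.mem_Icc.2 ⟨(permCycles_nonempty hC).card_pos, by simpa using C.card_le_univ⟩

theorem image_permOrbit (hτ : SemiconjBy τ k h) (x : Fin n) :
    (permOrbit k x).image τ = permOrbit h (τ x) := by
  rw [permOrbit, permOrbit, Finset.image_image]
  exact Finset.image_congr fun m _ => Equiv.congr_fun (hτ.pow_right m) x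

theorem image_mem_permCycles (hτ : SemiconjBy τ k h) (hC : C ∈ permCycles k) :
    C.image τ ∈ permCycles h := by
  obtain ⟨z, -, rfl⟩ := Finset.mem_image.1 hC
  rw [image_permOrbit hτ]
  exact permOrbit_mem_permCycles h _

/-- The bijection `C ↦ τ⁻¹(C)` from the cycles of `h` to those of `k`, when `τ k = h τ`. -/
def cycleEquiv (hτ : SemiconjBy τ k h) : permCycles h ≃ permCycles k where
  toFun C := ⟨C.1.image ⇑τ⁻¹, image_mem_permCycles hτ.inv_symm_left C.2⟩
  invFun D := ⟨D.1.image ⇑τ, image_mem_permCycles hτ D.2⟩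
  left_inv C := Subtype.ext (by simp [Finset.image_image, Function.comp_def])
  right_inv D := Subtype.ext (by simp [Finset.image_image, Function.comp_def])

theorem card_cycleEquiv (hτ : SemiconjBy τ k h) (C : permCycles h) :
    (cycleEquiv hτ C).1.card = C.1.card :=
  Finset.card_image_of_injective _ τ⁻¹.injective

theorem cycleEquiv_eq_iff (hτ : SemiconjBy τ k h) (e : permCycles h ≃ permCycles k) :
    cycleEquiv hτ = e ↔ ∀ C, (e C).1.image τ = C.1 := by
  constructor
  · rintro rfl C
    exact congrArg Subtype.val ((cycleEquiv hτ).symm_apply_apply C)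
  · intro H
    ext1 C
    apply (cycleEquiv hτ).symm.injective
    rw [Equiv.symm_apply_apply]
    exact Subtype.ext (H C).symm

/-- Every length-preserving permutation of the cycles of `h` is induced by a permutation commuting
with `h`. -/
theorem exists_commute_image_eq (π : Equiv.Perm (permCycles h))
    (hπ : ∀ C, (π C).1.card = C.1.card) :
    ∃ σ : Equiv.Perm (Fin n), Commute σ h ∧ ∀ C, C.1.image σ = (π C).1 := by
  classical
  choose b hb using fun C : permCycles h => permCycles_nonempty C.2
  have hcyc : ∀ C : permCycles h, h.IsCycleOn (C.1 : Set (Fin n)) := fun C => by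
    rw [← permOrbit_eq_of_mem C.2 (hb C)]
    exact isCycleOn_permOrbit h _
  let cyc : Fin n → permCycles h := fun y => ⟨permOrbit h y, permOrbit_mem_permCycles h y⟩
  have hmem : ∀ (C : permCycles h) (z : ℤ), (h ^ z) (b C) ∈ C.1 := fun C z => by
    rw [← permOrbit_eq_of_mem C.2 (hb C), mem_permOrbit]
    exact ⟨z, rfl⟩
  have hcycle : ∀ (C : permCycles h) (y), y ∈ C.1 → cyc y = C := fun C y hy =>
    Subtype.ext (permOrbit_eq_of_mem C.2 hy)
  have hex : ∀ y, ∃ z : ℤ, (h ^ z) (b (cyc y)) = y := fun y =>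
    (mem_permOrbit.1 (hb (cyc y))).symm
  choose m hm using hex
  let f : Fin n → Fin n := fun y => (h ^ m y) (b (π (cyc y)))
  have hf : ∀ (C : permCycles h) (z : ℤ), f ((h ^ z) (b C)) = (h ^ z) (b (π C)) := fun C z => by
    have h1 := hcycle C _ (hmem C z)
    have h2 := hm ((h ^ z) (b C))
    simp only [f]
    rw [h1] at h2 ⊢
    rw [(hcyc _).zpow_apply_eq_zpow_apply (hb _)] at h2 ⊢
    rwa [hπ]
  have hfmem : ∀ y, f y ∈ (π (cyc y)).1 := fun y => hmem _ _
  have hinj : Function.Injective f := fun y y' hyy' => by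
    have h1 : cyc y = cyc y' := by
      refine π.injective ?_
      rw [← hcycle _ _ (hfmem y), ← hcycle _ _ (hfmem y'), hyy']
    rw [← hm y, ← hm y', ← h1]
    simp only [f, ← h1] at hyy'
    rw [(hcyc _).zpow_apply_eq_zpow_apply (hb _)] at hyy' ⊢
    rwa [← hπ]
  refine ⟨Equiv.ofBijective f (Finite.injective_iff_bijective.1 hinj), ?_, fun C => ?_⟩
  · ext1 y
    simp only [Equiv.Perm.mul_apply, Equiv.ofBijective_apply]
    have h1 := hf (cyc y) (1 + m y)
    rw [zpow_one_add, Equiv.Perm.mul_apply, Equiv.Perm.mul_apply, hm] at h1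
    exact h1
  · refine Finset.eq_of_subset_of_card_le (fun w hw => ?_) ?_
    · obtain ⟨y, hy, rfl⟩ := Finset.mem_image.1 hw
      simpa [hcycle C y hy] using hfmem y
    · rw [hπ, Finset.card_image_of_injective _ (Equiv.injective _)]

theorem card_cycleEquiv_fiber_eq (e e' : permCycles h ≃ permCycles k)
    (he : ∀ C, (e C).1.card = C.1.card) (he' : ∀ C, (e' C).1.card = C.1.card) :
    Nat.card {t : {τ // SemiconjBy τ k h} // cycleEquiv t.2 = e} =
      Nat.card {t : {τ // SemiconjBy τ k h} // cycleEquiv t.2 = e'} := by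
  obtain ⟨σ, hσ, hσC⟩ := exists_commute_image_eq (e.trans e'.symm) fun C => by
    rw [← he', ← he C]; simp
  have hσ' : SemiconjBy σ h h := hσ
  refine Nat.card_congr (Equiv.subtypeEquiv
    (Equiv.subtypeEquiv (Equiv.mulLeft σ) fun τ => ?_) fun t => ?_)
  · refine ⟨fun hτ => hσ'.mul_left hτ, fun hτ => ?_⟩
    simpa using hσ'.inv_symm_left.mul_left hτ
  · rw [cycleEquiv_eq_iff, cycleEquiv_eq_iff]
    refine Iff.trans (forall_congr' fun C => ?_) (e.trans e'.symm).forall_congr_right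
    rw [← hσC C]
    simp only [Equiv.subtypeEquiv_apply, Equiv.coe_mulLeft, Equiv.Perm.coe_mul,
      ← Finset.image_image, Equiv.trans_apply, Equiv.apply_symm_apply]
    exact (Finset.image_injective σ.injective).eq_iff.symm

end Cycles

theorem Nat.card_subtype_comp_of_card_fiber {S E : Type*} [Finite S] [Finite E] (f : S → E) (c : ℕ)
    (hf : ∀ e, Nat.card {s // f s = e} = c) (R : E → Prop) :
    Nat.card {s // R (f s)} = Nat.card {e // R e} * c := by
  classical
  have := Fintype.ofFinite E
  have := Fintype.ofFinite {e // R e}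
  let g : {s // R (f s)} → {e // R e} := fun s => ⟨f s.1, s.2⟩
  rw [← Nat.card_congr (Equiv.sigmaFiberEquiv g), Nat.card_sigma]
  have : ∀ e : {e // R e}, Nat.card {s // g s = e} = c := fun e => by
    rw [← hf e.1]
    refine Nat.card_congr ⟨fun s => ⟨s.1.1, congrArg Subtype.val s.2⟩,
      fun s => ⟨⟨s.1, by rw [s.2]; exact e.2⟩, Subtype.ext s.2⟩, fun _ => rfl, fun _ => rfl⟩
  simp [this, Nat.card_eq_fintype_card]

theorem existsUnique_mem_blockF {n I : ℕ} {lam : Fin I → ℕ} (hsum : ∑ i, lam i = n) (x : Fin n) :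
    ∃! i, x ∈ blockF n lam i := by
  have hlt : ∀ i i', i < i' → blockOffset lam i + lam i ≤ blockOffset lam i' := fun i i' hi => by
    rw [blockOffset, add_comm, ← Finset.sum_insert (by simp)]
    refine Finset.sum_le_sum_of_subset fun j hj => ?_
    simp only [Finset.mem_insert, Finset.mem_filter, Finset.mem_univ, true_and] at hj ⊢
    omega
  refine existsUnique_of_exists_of_unique ?_ fun i i' hi hi' => ?_
  · subst hsum
    let s := finSigmaFinEquiv.symm x
    have hs : (x : ℕ) = blockOffset lam s.1 + s.2 := by
      rw [← finSigmaFinEquiv.apply_symm_apply x, finSigmaFinEquiv_apply]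
      congr 1
      refine Finset.sum_bij (fun j _ => Fin.castLE s.1.2.le j) (fun j _ => ?_)
        (fun _ _ _ _ hj => Fin.castLE_injective _ hj)
        (fun j hj => ⟨⟨j, (Finset.mem_filter.1 hj).2⟩, Finset.mem_univ _, rfl⟩) fun _ _ => rfl
      exact Finset.mem_filter.2 ⟨Finset.mem_univ _, j.2⟩
    refine ⟨s.1, ?_⟩
    simp [blockF, hs]
  · simp only [blockF, Finset.mem_filter, Finset.mem_univ, true_and] at hi hi'
    rcases lt_trichotomy i i' with h | h | h
    · have := hlt _ _ h; omega
    · exact h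
    · have := hlt _ _ h; omega

/-- Every cycle of `h ∈ S_λ` lies in exactly one block. -/
theorem exists_forall_subset_blockF_iff {n I : ℕ} {lam : Fin I → ℕ} (hsum : ∑ i, lam i = n)
    {h : Equiv.Perm (Fin n)} (hh : h ∈ young n lam) {C : Finset (Fin n)} (hC : C ∈ permCycles h) :
    ∃ i, ∀ i', C ⊆ blockF n lam i' ↔ i = i' := by
  obtain ⟨x, -, rfl⟩ := Finset.mem_image.1 hC
  obtain ⟨i, hi, hi'⟩ := existsUnique_mem_blockF hsum x
  refine ⟨i, fun i' => ⟨fun hs => (hi' _ (hs (self_mem_permOrbit h x))).symm, ?_⟩⟩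
  rintro rfl y hy
  obtain ⟨m, -, rfl⟩ := Finset.mem_image.1 hy
  clear hi' hy
  induction m with
  | zero => simpa
  | succ m ih =>
    rw [pow_succ', Equiv.Perm.mul_apply, ← hh i]
    exact Finset.mem_image_of_mem _ ih

theorem Nat.card_subtype_eq_card_filter {α : Type*} {s : Finset α} {q : s → Prop} {p : α → Prop}
    [DecidablePred p] (hqp : ∀ c : s, q c ↔ p c) :
    Nat.card {c // q c} = (s.filter p).card := by
  rw [Nat.card_congr (Equiv.subtypeEquivRight hqp),
    Nat.card_congr (Equiv.subtypeSubtypeEquivSubtypeInter (· ∈ s) p)]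
  exact Nat.subtype_card _ fun _ => Finset.mem_filter

/-- Fix `h ∈ S_λ`, `k ∈ S_μ` with `S_n^{h,k} = {τ : h⁻¹ τ k = τ}` nonempty, and let `τ`
be uniform on `S_n^{h,k}`.  Then the tables `X^{(l)}`, `l ≥ 1`, are mutually independent
and each `X^{(l)}` has the Fisher–Yates distribution with row sums `r^{(l)}` (the numbers
of `l`-cycles of the `h_i`) and column sums `c^{(l)}` (the numbers of `l`-cycles of the
`k_j`): the joint law is the product of the Fisher–Yates laws. -/
theorem cycle_tables_fisherYates_indep (n I J : ℕ) (lam : Fin I → ℕ) (mu : Fin J → ℕ)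
    (hlam : ∀ i, 0 < lam i) (hmu : ∀ j, 0 < mu j)
    (hlamsum : ∑ i, lam i = n) (hmusum : ∑ j, mu j = n)
    (h k : Equiv.Perm (Fin n))
    (hh : h ∈ young n lam) (hk : k ∈ young n mu)
    (hne : ∃ τ : Equiv.Perm (Fin n), h⁻¹ * τ * k = τ) :
    ∀ x : ℕ → Fin I → Fin J → ℕ,
      (Nat.card {τ : Equiv.Perm (Fin n) // h⁻¹ * τ * k = τ ∧
          ∀ l ∈ Finset.Icc 1 n, (fun i j => Xcount n lam mu h k τ l i j) = x l} : ℚ)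
        / (Nat.card {τ : Equiv.Perm (Fin n) // h⁻¹ * τ * k = τ} : ℚ)
      = ∏ l ∈ Finset.Icc 1 n,
          fisherYates (fun i => blockCycCount n lam h l i)
            (fun j => blockCycCount n mu k l j) (x l) := by
  classical
  intro x
  choose a ha using fun C : permCycles h => exists_forall_subset_blockF_iff hlamsum hh C.2
  choose b hb using fun D : permCycles k => exists_forall_subset_blockF_iff hmusum hk D.2
  let lh : permCycles h → Finset.Icc 1 n := fun C => ⟨C.1.card, card_mem_Icc_of_mem_permCycles C.2⟩
  let lk : permCycles k → Finset.Icc 1 n := fun D => ⟨D.1.card, card_mem_Icc_of_mem_permCycles D.2⟩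
  have hsemi : ∀ τ : Equiv.Perm (Fin n), h⁻¹ * τ * k = τ ↔ SemiconjBy τ k h := fun τ => by
    rw [mul_assoc, inv_mul_eq_iff_eq_mul]
    rfl
  have hlevel : ∀ e : permCycles h ≃ permCycles k, lk ∘ e = lh ↔ ∀ C, (e C).1.card = C.1.card :=
    fun e => funext_iff.trans (forall_congr' fun _ => Subtype.ext_iff)
  let Φ : {τ // SemiconjBy τ k h} → {e : permCycles h ≃ permCycles k // lk ∘ e = lh} :=
    fun t => ⟨cycleEquiv t.2, (hlevel _).2 (card_cycleEquiv t.2)⟩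
  obtain ⟨τ₀, hτ₀⟩ := hne
  have hfiber : ∀ e, Nat.card {t // Φ t = e} = Nat.card {t // Φ t = Φ ⟨τ₀, (hsemi τ₀).1 hτ₀⟩} := by
    intro e
    simpa only [Φ, Subtype.ext_iff] using
      card_cycleEquiv_fiber_eq e.1 _ ((hlevel _).1 e.2) (card_cycleEquiv _)
  have hfiber_pos : Nat.card {t // Φ t = Φ ⟨τ₀, (hsemi τ₀).1 hτ₀⟩} ≠ 0 :=
    Nat.card_ne_zero.2 ⟨⟨_, rfl⟩, inferInstance⟩
  have hcount := Nat.card_subtype_comp_of_card_fiber Φ _ hfiber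
  have hrow : ∀ (l : Finset.Icc 1 n) i, Nat.card {C // lh C = l ∧ a C = i} =
      blockCycCount n lam h l i := by
    intro l i
    exact Nat.card_subtype_eq_card_filter fun C => and_congr Subtype.ext_iff (ha C i).symm
  have hcol : ∀ (l : Finset.Icc 1 n) j, Nat.card {D // lk D = l ∧ b D = j} =
      blockCycCount n mu k l j := by
    intro l j
    exact Nat.card_subtype_eq_card_filter fun D => and_congr Subtype.ext_iff (hb D j).symm
  have htable : ∀ (t : {τ // SemiconjBy τ k h}) (l : Finset.Icc 1 n) i j,
      Nat.card {C // lh C = l ∧ a C = i ∧ b ((Φ t).1 C) = j} = Xcount n lam mu h k t l i j := by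
    intro t l i j
    refine Nat.card_subtype_eq_card_filter fun C =>
      and_congr Subtype.ext_iff (and_congr (ha C i).symm ?_)
    rw [← hb]
    exact ⟨fun H => ⟨(cycleEquiv t.2 C).2, H⟩, And.right⟩
  have key := card_level_tables_div_card lh lk a b ⟨_, (Φ ⟨τ₀, (hsemi τ₀).1 hτ₀⟩).2⟩ fun l => x l
  simp only [hrow, hcol] at key
  rw [← Finset.prod_coe_sort, ← key]
  have hnum : Nat.card {τ : Equiv.Perm (Fin n) // h⁻¹ * τ * k = τ ∧
      ∀ l ∈ Finset.Icc 1 n, (fun i j => Xcount n lam mu h k τ l i j) = x l} = _ :=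
    (Nat.card_congr ((Equiv.subtypeEquivRight fun τ => and_congr (hsemi τ) (by
      simp only [funext_iff, Subtype.forall])).trans
      (Equiv.subtypeSubtypeEquivSubtypeInter (SemiconjBy · k h) fun τ =>
        ∀ (l : Finset.Icc 1 n) i j, Xcount n lam mu h k τ l i j = x l i j).symm)).trans
    ((Nat.card_congr (Equiv.subtypeEquivRight fun t => by simp only [htable])).trans
      (hcount fun e => ∀ (l : Finset.Icc 1 n) i j,
        Nat.card {C // lh C = l ∧ a C = i ∧ b (e.1 C) = j} = x l i j))
  have hden := hcount fun _ => True
  rw [Nat.card_congr (Equiv.subtypeUnivEquiv fun _ => trivial),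
    Nat.card_congr (Equiv.subtypeUnivEquiv fun _ => trivial)] at hden
  rw [hnum, Nat.card_congr (Equiv.subtypeEquivRight hsemi), hden, Nat.cast_mul, Nat.cast_mul,
    mul_div_mul_right _ _ (Nat.cast_ne_zero.2 hfiber_pos),
    Nat.card_congr (Equiv.subtypeSubtypeEquivSubtypeInter
      (fun e : permCycles h ≃ permCycles k => lk ∘ e = lh) fun e => ∀ (l : Finset.Icc 1 n) i j,
        Nat.card {C // lh C = l ∧ a C = i ∧ b (e C) = j} = x l i j)]
end

section
/- Fix σ ∈ S_n and (h,k) in the stabilizer (S_λ × S_μ)_σ = {(h,k) : h⁻¹ σ k = σ}. For l ≥ 1 let a^{(l)}_{i,j} be the number of l-cycles of h contained in L_i ∩ σ(M_j), let r^{(l)}_i be the number of l-cycles of h contained in L_i, and let c^{(l)}_j be the number of l-cycles of k contained in M_j. Then r^{(l)}_i = Σ_{j=1}^J a^{(l)}_{i,j} and c^{(l)}_j = Σ_{i=1}^I a^{(l)}_{i,j} for all i, j, l. -/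
/-- `a^{(l)}_{i,j}`: the number of `l`-cycles of `h` contained in `L_i ∩ σ(M_j)`. -/
def meetCycCount (n : ℕ) {I J : ℕ} (lam : Fin I → ℕ) (mu : Fin J → ℕ)
    (σ h : Equiv.Perm (Fin n)) (l : ℕ) (i : Fin I) (j : Fin J) : ℕ :=
  ((permCycles h).filter (fun C =>
    C.card = l ∧ C ⊆ blockF n lam i ∩ (blockF n mu j).image ⇑σ)).card

theorem blockOffset_eq_sum_ite {I : ℕ} (lam : Fin I → ℕ) (i : Fin I) :
    blockOffset lam i = ∑ i', if i' < i then lam i' else 0 :=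
  Finset.sum_filter _ _

theorem exists_blockOffset_le_lt : ∀ {I : ℕ} (lam : Fin I → ℕ) (x : ℕ), x < ∑ i, lam i →
    ∃ i, blockOffset lam i ≤ x ∧ x < blockOffset lam i + lam i
  | 0, _, _, hx => by simp at hx
  | I + 1, lam, x, hx => by
    have hlast : blockOffset lam (Fin.last I) = ∑ i : Fin I, lam i.castSucc := by
      simp [blockOffset_eq_sum_ite, Fin.sum_univ_castSucc, Fin.castSucc_lt_last]
    rw [Fin.sum_univ_castSucc] at hx
    by_cases hlt : x < ∑ i : Fin I, lam i.castSucc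
    · obtain ⟨i, hi⟩ := exists_blockOffset_le_lt (fun i : Fin I => lam i.castSucc) x hlt
      have hcast : blockOffset lam i.castSucc = blockOffset (fun i : Fin I => lam i.castSucc) i := by
        simp [blockOffset_eq_sum_ite, Fin.sum_univ_castSucc, (Fin.castSucc_lt_last i).not_gt]
      exact ⟨i.castSucc, by rwa [hcast]⟩
    · exact ⟨Fin.last I, by omega⟩

theorem blockOffset_add_le {I : ℕ} (lam : Fin I → ℕ) {i j : Fin I} (hij : i < j) :
    blockOffset lam i + lam i ≤ blockOffset lam j := by
  unfold blockOffset
  rw [add_comm, ← Finset.sum_insert (by simp)]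
  refine Finset.sum_le_sum_of_subset fun a ha => ?_
  simp only [Finset.mem_insert, Finset.mem_filter, Finset.mem_univ, true_and] at ha ⊢
  rcases ha with rfl | ha
  · exact hij
  · exact ha.trans hij

theorem pow_apply_mem_iff {α : Type*} [DecidableEq α] {h : Equiv.Perm α} {S : Finset α}
    (hS : S.image h = S) (m : ℕ) (x : α) : (h ^ m) x ∈ S ↔ x ∈ S := by
  induction m with
  | zero => simp
  | succ m ih =>
    rw [pow_succ', Equiv.Perm.mul_apply, ← ih]
    nth_rw 1 [← hS]
    simp

theorem permOrbit_subset_iff {n : ℕ} {h : Equiv.Perm (Fin n)} {S : Finset (Fin n)}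
    (hS : S.image h = S) (x : Fin n) : permOrbit h x ⊆ S ↔ x ∈ S := by
  have hn : 0 < n := x.pos
  simp only [permOrbit, Finset.image_subset_iff, Finset.mem_range, pow_apply_mem_iff hS]
  exact ⟨fun H => H 0 hn, fun H _ _ => H⟩

/-- Counting cycles inside `S` according to the part of an invariant partition `B` containing
them. -/
theorem card_filter_permCycles_eq_sum {n : ℕ} {ι : Type*} [Fintype ι] {h : Equiv.Perm (Fin n)}
    {B : ι → Finset (Fin n)} (hB : ∀ i, (B i).image h = B i) (huniq : ∀ x, ∃! i, x ∈ B i)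
    (S : Finset (Fin n)) (l : ℕ) :
    ((permCycles h).filter fun C => C.card = l ∧ C ⊆ S).card =
      ∑ i, ((permCycles h).filter fun C => C.card = l ∧ C ⊆ S ∩ B i).card := by
  rw [← Finset.card_biUnion]
  · congr 1
    ext C
    simp only [Finset.mem_filter, Finset.mem_biUnion, Finset.mem_univ, true_and,
      Finset.subset_inter_iff]
    constructor
    · rintro ⟨hC, hl, hS⟩
      obtain ⟨x, -, rfl⟩ := Finset.mem_image.1 hC
      obtain ⟨i, hi, -⟩ := huniq x
      exact ⟨i, hC, hl, hS, (permOrbit_subset_iff (hB i) x).2 hi⟩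
    · rintro ⟨i, hC, hl, hS, -⟩
      exact ⟨hC, hl, hS⟩
  · intro i _ j _ hij
    refine Finset.disjoint_left.2 fun C hCi hCj => hij ?_
    simp only [Finset.mem_filter, Finset.subset_inter_iff] at hCi hCj
    obtain ⟨x, -, rfl⟩ := Finset.mem_image.1 hCi.1
    exact (huniq x).unique ((permOrbit_subset_iff (hB i) x).1 hCi.2.2.2)
      ((permOrbit_subset_iff (hB j) x).1 hCj.2.2.2)

theorem permOrbit_apply_of_semiconj {n : ℕ} {σ h k : Equiv.Perm (Fin n)} (hc : σ * k = h * σ)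
    (x : Fin n) : permOrbit h (σ x) = (permOrbit k x).image σ := by
  have hpow (m : ℕ) : (h ^ m) (σ x) = σ ((k ^ m) x) := by
    have hm : σ * k ^ m = h ^ m * σ := SemiconjBy.pow_right hc m
    exact (DFunLike.congr_fun hm x).symm
  simp only [permOrbit, Finset.image_image]
  exact Finset.image_congr fun m _ => hpow m

theorem permCycles_eq_image_of_semiconj {n : ℕ} {σ h k : Equiv.Perm (Fin n)}
    (hc : σ * k = h * σ) : permCycles h = (permCycles k).image (Finset.image σ) := by
  ext C
  simp only [permCycles, Finset.image_image, Finset.mem_image, Finset.mem_univ, true_and,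
    Function.comp_apply, ← permOrbit_apply_of_semiconj hc]
  exact (σ.surjective.exists (p := fun y => permOrbit h y = C))

theorem card_filter_permCycles_of_semiconj {n : ℕ} {σ h k : Equiv.Perm (Fin n)}
    (hc : σ * k = h * σ) (S : Finset (Fin n)) (l : ℕ) :
    ((permCycles k).filter fun C => C.card = l ∧ C ⊆ S).card =
      ((permCycles h).filter fun C => C.card = l ∧ C ⊆ S.image σ).card := by
  rw [permCycles_eq_image_of_semiconj hc, Finset.filter_image,
    Finset.card_image_of_injective _ (Finset.image_injective σ.injective)]
  simp [Finset.card_image_of_injective _ σ.injective,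
    Finset.image_subset_image_iff σ.injective]

/-- Fix `σ ∈ S_n` and `(h,k)` in the stabilizer `(S_λ × S_μ)_σ = {(h,k) : h⁻¹ σ k = σ}`.
With `r^{(l)}_i` the number of `l`-cycles of `h` in `L_i`, `c^{(l)}_j` the number of
`l`-cycles of `k` in `M_j`, and `a^{(l)}_{i,j}` the number of `l`-cycles of `h` in
`L_i ∩ σ(M_j)`, one has `r^{(l)}_i = Σ_j a^{(l)}_{i,j}` and `c^{(l)}_j = Σ_i a^{(l)}_{i,j}`. -/
theorem margins_of_meet_cycles (n I J : ℕ) (lam : Fin I → ℕ) (mu : Fin J → ℕ)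
    (hlam : ∀ i, 0 < lam i) (hmu : ∀ j, 0 < mu j)
    (hlamsum : ∑ i, lam i = n) (hmusum : ∑ j, mu j = n)
    (σ h k : Equiv.Perm (Fin n))
    (hh : h ∈ young n lam) (hk : k ∈ young n mu)
    (hfix : h⁻¹ * σ * k = σ) :
    (∀ (l : ℕ) (i : Fin I),
        blockCycCount n lam h l i = ∑ j, meetCycCount n lam mu σ h l i j) ∧
    (∀ (l : ℕ) (j : Fin J),
        blockCycCount n mu k l j = ∑ i, meetCycCount n lam mu σ h l i j) := by
  have hc : σ * k = h * σ := by
    rw [mul_assoc, inv_mul_eq_iff_eq_mul] at hfix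
    exact hfix
  refine ⟨fun l i => card_filter_permCycles_eq_sum (fun j => ?_) (fun x => ?_) _ l, fun l j => ?_⟩
  · rw [Finset.image_image, ← Equiv.Perm.coe_mul, ← hc, Equiv.Perm.coe_mul, ← Finset.image_image,
      hk j]
  · have hmem (j : Fin J) : x ∈ (blockF n mu j).image σ ↔ σ.symm x ∈ blockF n mu j := by
      simp [Finset.mem_image, ← Equiv.eq_symm_apply]
    simpa only [hmem] using existsUnique_mem_blockF hmusum (σ.symm x)
  · rw [blockCycCount, card_filter_permCycles_of_semiconj hc,
      card_filter_permCycles_eq_sum hh (existsUnique_mem_blockF hlamsum)]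
    simp only [meetCycCount, Finset.inter_comm]
end
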